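/- Let G := s₂² − 4s₄ ∈ ℚ[X₁, X₂, X₃, X₆, X₇] be the defining polynomial of Igusa's quartic threefold, where s_i is the i-th elementary symmetric polynomial in the five variables X₁, X₂, X₃, X₆, X₇. Then there exists a nonzero constant c ∈ ℚ such that F(X₁+X₂+X₃+X₆+X₇, X₁, X₂, X₃, X₆, X₇) = c · det(∂²G/∂X_i∂X_j)_{i,j ∈ {1,2,3,6,7}}, i.e., the hyperplane section of 𝒳 by the reflection hyperplane H_α : X₀ = X₁+X₂+X₃+X₆+X₇ is the Hessian hypersurface 𝒲₁₀ of Igusa's quartic. -/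

import Mathlib

open MvPolynomial in
/-- The degree-10 polynomial `F = F₁₀ − X₀X₁X₂X₃X₆X₇·F₄` defining the Picard modular
fourfold `𝒳 ⊂ P⁵`. The variables `X 0, X 1, X 2, X 3, X 4, X 5` stand for the
coordinates `X₀, X₁, X₂, X₃, X₆, X₇`, and `Sᵢ` is the `i`-th elementary symmetric
polynomial in the five squares `X₁², X₂², X₃², X₆², X₇²`. -/
noncomputable def Fpoly : MvPolynomial (Fin 6) ℚ :=
  let a := X 1 ^ 2; let b := X 2 ^ 2; let c := X 3 ^ 2; let d := X 4 ^ 2; let e := X 5 ^ 2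
  let S1 := a + b + c + d + e
  let S2 := a*b + a*c + a*d + a*e + b*c + b*d + b*e + c*d + c*e + d*e
  let S3 := a*b*c + a*b*d + a*b*e + a*c*d + a*c*e + a*d*e + b*c*d + b*c*e + b*d*e + c*d*e
  let S4 := a*b*c*d + a*b*c*e + a*b*d*e + a*c*d*e + b*c*d*e
  let S5 := a*b*c*d*e
  let F4 := -6*S1^2 + 16*S2 + 4*S1*(X 0)^2 + 2*(X 0)^4
  let F10 := S1*S2^2 - 3*S1^2*S3 + 12*S1*S4 - 48*S5 + (-S2^2 + 2*S1*S3 + 4*S4)*(X 0)^2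
      + S3*(X 0)^4
  F10 - X 0 * X 1 * X 2 * X 3 * X 4 * X 5 * F4

open MvPolynomial in
/-- Igusa's quartic `G = s₂² − 4s₄`, where `sᵢ` is the `i`-th elementary symmetric
polynomial in the five variables `X₁, X₂, X₃, X₆, X₇` (indexed here by `Fin 5`). -/
noncomputable def Gpoly : MvPolynomial (Fin 5) ℚ :=
  let x0 := X 0; let x1 := X 1; let x2 := X 2; let x3 := X 3; let x4 := X 4
  let s2 := x0*x1 + x0*x2 + x0*x3 + x0*x4 + x1*x2 + x1*x3 + x1*x4 + x2*x3 + x2*x4 + x3*x4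
  let s4 := x0*x1*x2*x3 + x0*x1*x2*x4 + x0*x1*x3*x4 + x0*x2*x3*x4 + x1*x2*x3*x4
  s2^2 - 4*s4

theorem Matrix.det_fin_four {R : Type*} [CommRing R] (M : Matrix (Fin 4) (Fin 4) R) :
    M.det =
      M 0 0 * (M 1 1 * (M 2 2 * M 3 3 - M 2 3 * M 3 2) - M 1 2 * (M 2 1 * M 3 3 - M 2 3 * M 3 1) +
        M 1 3 * (M 2 1 * M 3 2 - M 2 2 * M 3 1)) -
      M 0 1 * (M 1 0 * (M 2 2 * M 3 3 - M 2 3 * M 3 2) - M 1 2 * (M 2 0 * M 3 3 - M 2 3 * M 3 0) +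
        M 1 3 * (M 2 0 * M 3 2 - M 2 2 * M 3 0)) +
      M 0 2 * (M 1 0 * (M 2 1 * M 3 3 - M 2 3 * M 3 1) - M 1 1 * (M 2 0 * M 3 3 - M 2 3 * M 3 0) +
        M 1 3 * (M 2 0 * M 3 1 - M 2 1 * M 3 0)) -
      M 0 3 * (M 1 0 * (M 2 1 * M 3 2 - M 2 2 * M 3 1) - M 1 1 * (M 2 0 * M 3 2 - M 2 2 * M 3 0) +
        M 1 2 * (M 2 0 * M 3 1 - M 2 1 * M 3 0)) := by
  have h0 : (0 : Fin 4).succAbove = ![1, 2, 3] := by decide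
  have h1 : (1 : Fin 4).succAbove = ![0, 2, 3] := by decide
  have h2 : (2 : Fin 4).succAbove = ![0, 1, 3] := by decide
  have h3 : (3 : Fin 4).succAbove = ![0, 1, 2] := by decide
  have hs : (Fin.succ : Fin 3 → Fin 4) = ![1, 2, 3] := by decide
  rw [Matrix.det_succ_row_zero, Fin.sum_univ_four, h0, h1, h2, h3, hs]
  simp only [Matrix.det_fin_three]
  simp
  ring

/-- Laplace expansion of a `5 × 5` determinant along the first two rows. -/
theorem Matrix.det_fin_five {R : Type*} [CommRing R] (M : Matrix (Fin 5) (Fin 5) R) :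
    M.det =
      (M 0 0 * M 1 1 - M 0 1 * M 1 0) *
        (M 2 2 * (M 3 3 * M 4 4 - M 3 4 * M 4 3) - M 2 3 * (M 3 2 * M 4 4 - M 3 4 * M 4 2) +
          M 2 4 * (M 3 2 * M 4 3 - M 3 3 * M 4 2)) -
      (M 0 0 * M 1 2 - M 0 2 * M 1 0) *
        (M 2 1 * (M 3 3 * M 4 4 - M 3 4 * M 4 3) - M 2 3 * (M 3 1 * M 4 4 - M 3 4 * M 4 1) +
          M 2 4 * (M 3 1 * M 4 3 - M 3 3 * M 4 1)) +
      (M 0 0 * M 1 3 - M 0 3 * M 1 0) *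
        (M 2 1 * (M 3 2 * M 4 4 - M 3 4 * M 4 2) - M 2 2 * (M 3 1 * M 4 4 - M 3 4 * M 4 1) +
          M 2 4 * (M 3 1 * M 4 2 - M 3 2 * M 4 1)) -
      (M 0 0 * M 1 4 - M 0 4 * M 1 0) *
        (M 2 1 * (M 3 2 * M 4 3 - M 3 3 * M 4 2) - M 2 2 * (M 3 1 * M 4 3 - M 3 3 * M 4 1) +
          M 2 3 * (M 3 1 * M 4 2 - M 3 2 * M 4 1)) +
      (M 0 1 * M 1 2 - M 0 2 * M 1 1) *
        (M 2 0 * (M 3 3 * M 4 4 - M 3 4 * M 4 3) - M 2 3 * (M 3 0 * M 4 4 - M 3 4 * M 4 0) +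
          M 2 4 * (M 3 0 * M 4 3 - M 3 3 * M 4 0)) -
      (M 0 1 * M 1 3 - M 0 3 * M 1 1) *
        (M 2 0 * (M 3 2 * M 4 4 - M 3 4 * M 4 2) - M 2 2 * (M 3 0 * M 4 4 - M 3 4 * M 4 0) +
          M 2 4 * (M 3 0 * M 4 2 - M 3 2 * M 4 0)) +
      (M 0 1 * M 1 4 - M 0 4 * M 1 1) *
        (M 2 0 * (M 3 2 * M 4 3 - M 3 3 * M 4 2) - M 2 2 * (M 3 0 * M 4 3 - M 3 3 * M 4 0) +
          M 2 3 * (M 3 0 * M 4 2 - M 3 2 * M 4 0)) +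
      (M 0 2 * M 1 3 - M 0 3 * M 1 2) *
        (M 2 0 * (M 3 1 * M 4 4 - M 3 4 * M 4 1) - M 2 1 * (M 3 0 * M 4 4 - M 3 4 * M 4 0) +
          M 2 4 * (M 3 0 * M 4 1 - M 3 1 * M 4 0)) -
      (M 0 2 * M 1 4 - M 0 4 * M 1 2) *
        (M 2 0 * (M 3 1 * M 4 3 - M 3 3 * M 4 1) - M 2 1 * (M 3 0 * M 4 3 - M 3 3 * M 4 0) +
          M 2 3 * (M 3 0 * M 4 1 - M 3 1 * M 4 0)) +
      (M 0 3 * M 1 4 - M 0 4 * M 1 3) *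
        (M 2 0 * (M 3 1 * M 4 2 - M 3 2 * M 4 1) - M 2 1 * (M 3 0 * M 4 2 - M 3 2 * M 4 0) +
          M 2 2 * (M 3 0 * M 4 1 - M 3 1 * M 4 0)) := by
  have h0 : (0 : Fin 5).succAbove = ![1, 2, 3, 4] := by decide
  have h1 : (1 : Fin 5).succAbove = ![0, 2, 3, 4] := by decide
  have h2 : (2 : Fin 5).succAbove = ![0, 1, 3, 4] := by decide
  have h3 : (3 : Fin 5).succAbove = ![0, 1, 2, 4] := by decide
  have h4 : (4 : Fin 5).succAbove = ![0, 1, 2, 3] := by decide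
  have hs : (Fin.succ : Fin 4 → Fin 5) = ![1, 2, 3, 4] := by decide
  rw [Matrix.det_succ_row_zero, Fin.sum_univ_five, h0, h1, h2, h3, h4, hs]
  simp only [Matrix.det_fin_four]
  simp
  ring

/-- Expansion of the determinant of a diagonal matrix plus a matrix `K` in the principal minors
of `K`. -/
theorem Matrix.det_diagonal_add_fin_five {R : Type*} [CommRing R] (f : Fin 5 → R)
    (K : Matrix (Fin 5) (Fin 5) R) :
    (Matrix.diagonal f + K).det =
      f 0 * f 1 * f 2 * f 3 * f 4 +
      f 1 * f 2 * f 3 * f 4 * K 0 0 +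
      f 0 * f 2 * f 3 * f 4 * K 1 1 +
      f 0 * f 1 * f 3 * f 4 * K 2 2 +
      f 0 * f 1 * f 2 * f 4 * K 3 3 +
      f 0 * f 1 * f 2 * f 3 * K 4 4 +
      f 2 * f 3 * f 4 * (K.submatrix ![0, 1] ![0, 1]).det +
      f 1 * f 3 * f 4 * (K.submatrix ![0, 2] ![0, 2]).det +
      f 1 * f 2 * f 4 * (K.submatrix ![0, 3] ![0, 3]).det +
      f 1 * f 2 * f 3 * (K.submatrix ![0, 4] ![0, 4]).det +
      f 0 * f 3 * f 4 * (K.submatrix ![1, 2] ![1, 2]).det +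
      f 0 * f 2 * f 4 * (K.submatrix ![1, 3] ![1, 3]).det +
      f 0 * f 2 * f 3 * (K.submatrix ![1, 4] ![1, 4]).det +
      f 0 * f 1 * f 4 * (K.submatrix ![2, 3] ![2, 3]).det +
      f 0 * f 1 * f 3 * (K.submatrix ![2, 4] ![2, 4]).det +
      f 0 * f 1 * f 2 * (K.submatrix ![3, 4] ![3, 4]).det +
      f 3 * f 4 * (K.submatrix ![0, 1, 2] ![0, 1, 2]).det +
      f 2 * f 4 * (K.submatrix ![0, 1, 3] ![0, 1, 3]).det +
      f 2 * f 3 * (K.submatrix ![0, 1, 4] ![0, 1, 4]).det +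
      f 1 * f 4 * (K.submatrix ![0, 2, 3] ![0, 2, 3]).det +
      f 1 * f 3 * (K.submatrix ![0, 2, 4] ![0, 2, 4]).det +
      f 1 * f 2 * (K.submatrix ![0, 3, 4] ![0, 3, 4]).det +
      f 0 * f 4 * (K.submatrix ![1, 2, 3] ![1, 2, 3]).det +
      f 0 * f 3 * (K.submatrix ![1, 2, 4] ![1, 2, 4]).det +
      f 0 * f 2 * (K.submatrix ![1, 3, 4] ![1, 3, 4]).det +
      f 0 * f 1 * (K.submatrix ![2, 3, 4] ![2, 3, 4]).det +
      f 4 * (K.submatrix ![0, 1, 2, 3] ![0, 1, 2, 3]).det +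
      f 3 * (K.submatrix ![0, 1, 2, 4] ![0, 1, 2, 4]).det +
      f 2 * (K.submatrix ![0, 1, 3, 4] ![0, 1, 3, 4]).det +
      f 1 * (K.submatrix ![0, 2, 3, 4] ![0, 2, 3, 4]).det +
      f 0 * (K.submatrix ![1, 2, 3, 4] ![1, 2, 3, 4]).det +
      K.det := by
  simp only [Matrix.det_fin_five, Matrix.det_fin_four, Matrix.det_fin_three, Matrix.det_fin_two]
  simp
  ring

theorem Matrix.det_mul_eq_zero_of_lt {R : Type*} [CommRing R] {k m : ℕ}
    (A : Matrix (Fin (k + (m + 1))) (Fin k) R) (B : Matrix (Fin k) (Fin (k + (m + 1))) R) :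
    (A * B).det = 0 := by
  let A' : Matrix (Fin (k + (m + 1))) (Fin (k + (m + 1))) R :=
    Matrix.of fun i l => Fin.addCases (motive := fun _ => R) (fun l => A i l) (fun _ => 0) l
  let B' : Matrix (Fin (k + (m + 1))) (Fin (k + (m + 1))) R :=
    Matrix.of fun l j => Fin.addCases (motive := fun _ => R) (fun l => B l j) (fun _ => 0) l
  have h : A * B = A' * B' := by
    ext i j
    simp [A', B', Matrix.mul_apply, Fin.sum_univ_add]
  rw [h, Matrix.det_mul, Matrix.det_eq_zero_of_row_eq_zero (A := B') (Fin.natAdd k 0), mul_zero]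
  intro j
  simp [B']

/-- The part of rank at most three in the decomposition of half the Hessian matrix of Igusa's
quartic as a diagonal matrix plus a matrix of low rank. -/
def hessKernel {R : Type*} [CommRing R] {n : ℕ} (s t : R) (x : Fin n → R) :
    Matrix (Fin n) (Fin n) R :=
  Matrix.of fun i j => s^2 - t + s*(x i + x j) - x i * x j - 2*x i^2 - 2*x j^2

/-- The diagonal part in the decomposition of half the Hessian matrix of Igusa's quartic. -/
def hessDiag {R : Type*} [CommRing R] (s t x : R) : R := 6*x^2 - 4*s*x + t

/-- The diagonal entries of `hessKernel`. -/
def hessMinorOne {R : Type*} [CommRing R] (s t x : R) : R := s^2 - t + 2*s*x - 5*x^2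

/-- The principal `2 × 2` minors of `hessKernel`. -/
def hessMinorTwo {R : Type*} [CommRing R] (s t x y : R) : R :=
  (x - y)^2 * (t - 2*s^2 + 4*s*(x + y) - 4*x*y - 4*(x + y)^2)

/-- The principal `3 × 3` minors of `hessKernel`. -/
def hessMinorThree {R : Type*} [CommRing R] (x y z : R) : R :=
  4 * ((x - y) * (x - z) * (y - z))^2

theorem hessKernel_apply_self {R : Type*} [CommRing R] {n : ℕ} (s t : R) (x : Fin n → R)
    (i : Fin n) : hessKernel s t x i i = hessMinorOne s t (x i) := by
  simp only [hessKernel, hessMinorOne, Matrix.of_apply]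
  ring

theorem hessKernel_submatrix {R : Type*} [CommRing R] {m n : ℕ} (s t : R) (x : Fin n → R)
    (g : Fin m → Fin n) : (hessKernel s t x).submatrix g g = hessKernel s t (x ∘ g) :=
  rfl

theorem det_hessKernel_two {R : Type*} [CommRing R] (s t : R) (x : Fin 2 → R) :
    (hessKernel s t x).det = hessMinorTwo s t (x 0) (x 1) := by
  simp only [hessKernel, hessMinorTwo, Matrix.det_fin_two, Matrix.of_apply]
  ring

theorem det_hessKernel_three {R : Type*} [CommRing R] (s t : R) (x : Fin 3 → R) :
    (hessKernel s t x).det = hessMinorThree (x 0) (x 1) (x 2) := by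
  simp only [hessKernel, hessMinorThree, Matrix.det_fin_three, Matrix.of_apply]
  ring

theorem det_hessKernel_eq_zero {R : Type*} [CommRing R] {m : ℕ} (s t : R)
    (x : Fin (3 + (m + 1)) → R) : (hessKernel s t x).det = 0 := by
  have h : hessKernel s t x =
      (Matrix.of fun i => ![1, x i, x i^2] : Matrix (Fin (3 + (m + 1))) (Fin 3) R) *
        Matrix.of ![fun j => s^2 - t + s * x j - 2*x j^2, fun j => s - x j, fun _ => -2] := by
    ext i j
    simp [hessKernel, Matrix.mul_apply, Fin.sum_univ_three]
    ring
  rw [h, Matrix.det_mul_eq_zero_of_lt]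

theorem sum_hessDiag_prod {R : Type*} [CommRing R] {a b c d e e1 e2 e3 e4 e5 : R} (s t : R)
    (h1 : e1 = a + b + c + d + e)
    (h2 : e2 = a*b + a*c + a*d + a*e + b*c + b*d + b*e + c*d + c*e + d*e)
    (h3 : e3 = a*b*c + a*b*d + a*b*e + a*c*d + a*c*e + a*d*e + b*c*d + b*c*e + b*d*e + c*d*e)
    (h4 : e4 = a*b*c*d + a*b*c*e + a*b*d*e + a*c*d*e + b*c*d*e) (h5 : e5 = a*b*c*d*e) :
    hessDiag s t a * hessDiag s t b * hessDiag s t c * hessDiag s t d * hessDiag s t e =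
      7776*e5^2 + (-2592*e3*e5 + 1296*e4^2)*t + (432*e1*e5 - 432*e2*e4 + 216*e3^2)*t^2 +
      (-72*e1*e3 + 36*e2^2 + 72*e4)*t^3 + (6*e1^2 - 12*e2)*t^4 + t^5 + -5184*e4*e5*s + (2592*e2*e5
      - 864*e3*e4)*s*t + (432*e1*e4 - 144*e2*e3 - 720*e5)*s*t^2 + (-24*e1*e2 + 72*e3)*s*t^3 +
      -4*e1*s*t^4 + 3456*e3*e5*s^2 + (-2304*e1*e5 + 576*e2*e4)*s^2*t + (96*e1*e3 - 384*e4)*s^2*t^2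
      + 16*e2*s^2*t^3 + -2304*e2*e5*s^3 + (-384*e1*e4 + 1920*e5)*s^3*t + -64*e3*s^3*t^2 +
      1536*e1*e5*s^4 + 256*e4*s^4*t + -1024*e5*s^5 := by
  subst h1 h2 h3 h4 h5
  simp only [hessDiag]
  ring

theorem sum_hessMinorOne {R : Type*} [CommRing R] {a b c d e e1 e2 e3 e4 e5 : R} (s t : R)
    (h1 : e1 = a + b + c + d + e)
    (h2 : e2 = a*b + a*c + a*d + a*e + b*c + b*d + b*e + c*d + c*e + d*e)
    (h3 : e3 = a*b*c + a*b*d + a*b*e + a*c*d + a*c*e + a*d*e + b*c*d + b*c*e + b*d*e + c*d*e)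
    (h4 : e4 = a*b*c*d + a*b*c*e + a*b*d*e + a*c*d*e + b*c*d*e) (h5 : e5 = a*b*c*d*e) :
    hessDiag s t b * hessDiag s t c * hessDiag s t d * hessDiag s t e * hessMinorOne s t a +
    hessDiag s t a * hessDiag s t c * hessDiag s t d * hessDiag s t e * hessMinorOne s t b +
    hessDiag s t a * hessDiag s t b * hessDiag s t d * hessDiag s t e * hessMinorOne s t c +
    hessDiag s t a * hessDiag s t b * hessDiag s t c * hessDiag s t e * hessMinorOne s t d +
    hessDiag s t a * hessDiag s t b * hessDiag s t c * hessDiag s t d * hessMinorOne s t e =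
      -32400*e5^2 + (11232*e3*e5 - 5616*e4^2)*t + (-1944*e1*e5 + 1944*e2*e4 - 972*e3^2)*t^2 +
      (336*e1*e3 - 168*e2^2 - 336*e4)*t^3 + (-29*e1^2 + 58*e2)*t^4 + -5*t^5 + 19872*e4*e5*s +
      (-10368*e2*e5 + 3456*e3*e4)*s*t + (-1800*e1*e4 + 600*e2*e3 + 3000*e5)*s*t^2 + (104*e1*e2 -
      312*e3)*s*t^3 + 18*e1*s*t^4 + (-14688*e3*e5 + 1296*e4^2)*s^2 + (9312*e1*e5 - 2976*e2*e4 +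
      432*e3^2)*s^2*t + (-584*e1*e3 + 108*e2^2 + 1688*e4)*s^2*t^2 + (24*e1^2 - 112*e2)*s^2*t^3 +
      5*s^2*t^4 + (9888*e2*e5 - 864*e3*e4)*s^3 + (2144*e1*e4 - 288*e2*e3 - 7840*e5)*s^3*t +
      (-72*e1*e2 + 440*e3)*s^3*t^2 + -16*e1*s^3*t^3 + (-6656*e1*e5 + 576*e2*e4)*s^4 + (192*e1*e3 -
      1536*e4)*s^4*t + 48*e2*s^4*t^2 + (-384*e1*e4 + 4480*e5)*s^5 + -128*e3*s^5*t + 256*e4*s^6 := by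
  subst h1 h2 h3 h4 h5
  simp only [hessDiag, hessMinorOne]
  ring

theorem sum_hessMinorTwo {R : Type*} [CommRing R] {a b c d e e1 e2 e3 e4 e5 : R} (s t : R)
    (h1 : e1 = a + b + c + d + e)
    (h2 : e2 = a*b + a*c + a*d + a*e + b*c + b*d + b*e + c*d + c*e + d*e)
    (h3 : e3 = a*b*c + a*b*d + a*b*e + a*c*d + a*c*e + a*d*e + b*c*d + b*c*e + b*d*e + c*d*e)
    (h4 : e4 = a*b*c*d + a*b*c*e + a*b*d*e + a*c*d*e + b*c*d*e) (h5 : e5 = a*b*c*d*e) :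
    hessDiag s t c * hessDiag s t d * hessDiag s t e * hessMinorTwo s t a b +
    hessDiag s t b * hessDiag s t d * hessDiag s t e * hessMinorTwo s t a c +
    hessDiag s t b * hessDiag s t c * hessDiag s t e * hessMinorTwo s t a d +
    hessDiag s t b * hessDiag s t c * hessDiag s t d * hessMinorTwo s t a e +
    hessDiag s t a * hessDiag s t d * hessDiag s t e * hessMinorTwo s t b c +
    hessDiag s t a * hessDiag s t c * hessDiag s t e * hessMinorTwo s t b d +
    hessDiag s t a * hessDiag s t c * hessDiag s t d * hessMinorTwo s t b e +
    hessDiag s t a * hessDiag s t b * hessDiag s t e * hessMinorTwo s t c d +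
    hessDiag s t a * hessDiag s t b * hessDiag s t d * hessMinorTwo s t c e +
    hessDiag s t a * hessDiag s t b * hessDiag s t c * hessMinorTwo s t d e =
      (1728*e1^2*e3*e5 - 864*e1^2*e4^2 - 864*e1*e4*e5 - 3456*e2*e3*e5 + 1728*e2*e4^2 + 43200*e5^2)
      + (-576*e1^3*e5 + 576*e1^2*e2*e4 - 288*e1^2*e3^2 + 1584*e1*e2*e5 - 144*e1*e3*e4 -
      1152*e2^2*e4 + 576*e2*e3^2 - 12240*e3*e5 + 6048*e4^2)*t + (144*e1^3*e3 - 72*e1^2*e2^2 -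
      72*e1^2*e4 - 312*e1*e2*e3 + 1560*e1*e5 + 144*e2^3 - 1320*e2*e4 + 792*e3^2)*t^2 + (-16*e1^4 +
      60*e1^2*e2 - 176*e1*e3 + 28*e2^2 + 200*e4)*t^3 + (4*e1^2 - 10*e2)*t^4 + (-1728*e1^2*e2*e5 +
      576*e1^2*e3*e4 + 576*e1*e3*e5 + 288*e1*e4^2 + 3456*e2^2*e5 - 1152*e2*e3*e4 - 24480*e4*e5)*s
      + (-576*e1^3*e4 + 192*e1^2*e2*e3 + 384*e1^2*e5 + 1152*e1*e2*e4 + 96*e1*e3^2 - 384*e2^2*e3 +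
      8160*e2*e5 - 3264*e3*e4)*s*t + (48*e1^3*e2 - 160*e1^2*e3 - 72*e1*e2^2 + 1144*e1*e4 -
      104*e2*e3 - 2200*e5)*s*t^2 + (16*e1^3 - 64*e1*e2 + 120*e3)*s*t^3 + (1536*e1^3*e5 -
      384*e1^2*e2*e4 - 3648*e1*e2*e5 - 192*e1*e3*e4 + 768*e2^2*e4 + 15840*e3*e5 - 960*e4^2)*s^2 +
      (-128*e1^3*e3 + 512*e1^2*e4 + 192*e1*e2*e3 - 7200*e1*e5 + 1200*e2*e4 - 240*e3^2)*s^2*t +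
      (-48*e1^2*e2 + 280*e1*e3 + 24*e2^2 - 880*e4)*s^2*t^2 + (-8*e1^2 + 20*e2)*s^2*t^3 +
      (256*e1^3*e4 - 768*e1^2*e5 - 384*e1*e2*e4 - 6880*e2*e5 + 480*e3*e4)*s^3 + (128*e1^2*e3 -
      1248*e1*e4 - 64*e2*e3 + 5600*e5)*s^3*t + (24*e1*e2 - 120*e3)*s^3*t^2 + (-256*e1^2*e4 +
      5120*e1*e5 + 128*e2*e4)*s^4 + (-64*e1*e3 + 640*e4)*s^4*t + (128*e1*e4 - 3200*e5)*s^5 := by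
  subst h1 h2 h3 h4 h5
  simp only [hessDiag, hessMinorTwo]
  ring

theorem sum_hessMinorThree {R : Type*} [CommRing R] {a b c d e e1 e2 e3 e4 e5 : R} (s t : R)
    (h1 : e1 = a + b + c + d + e)
    (h2 : e2 = a*b + a*c + a*d + a*e + b*c + b*d + b*e + c*d + c*e + d*e)
    (h3 : e3 = a*b*c + a*b*d + a*b*e + a*c*d + a*c*e + a*d*e + b*c*d + b*c*e + b*d*e + c*d*e)
    (h4 : e4 = a*b*c*d + a*b*c*e + a*b*d*e + a*c*d*e + b*c*d*e) (h5 : e5 = a*b*c*d*e) :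
    hessDiag s t d * hessDiag s t e * hessMinorThree a b c +
    hessDiag s t c * hessDiag s t e * hessMinorThree a b d +
    hessDiag s t c * hessDiag s t d * hessMinorThree a b e +
    hessDiag s t b * hessDiag s t e * hessMinorThree a c d +
    hessDiag s t b * hessDiag s t d * hessMinorThree a c e +
    hessDiag s t b * hessDiag s t c * hessMinorThree a d e +
    hessDiag s t a * hessDiag s t e * hessMinorThree b c d +
    hessDiag s t a * hessDiag s t d * hessMinorThree b c e +
    hessDiag s t a * hessDiag s t c * hessMinorThree b d e +
    hessDiag s t a * hessDiag s t b * hessMinorThree c d e =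
      (-1152*e1^2*e3*e5 + 432*e1^2*e4^2 + 1440*e1*e4*e5 + 2880*e2*e3*e5 - 1152*e2*e4^2 -
      18000*e5^2) + (384*e1^3*e5 - 240*e1^2*e2*e4 + 96*e1^2*e3^2 - 1680*e1*e2*e5 + 240*e1*e3*e4 +
      672*e2^2*e4 - 288*e2*e3^2 + 3600*e3*e5 - 1920*e4^2)*t + (-32*e1^3*e3 + 12*e1^2*e2^2 -
      64*e1^2*e4 + 152*e1*e2*e3 - 48*e2^3 + 160*e2*e4 - 180*e3^2)*t^2 + (1152*e1^2*e2*e5 -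
      192*e1^2*e3*e4 - 960*e1*e3*e5 - 384*e1*e4^2 - 2880*e2^2*e5 + 576*e2*e3*e4 + 9600*e4*e5)*s +
      (192*e1^3*e4 - 32*e1^2*e2*e3 + 320*e1^2*e5 - 672*e1*e2*e4 - 96*e1*e3^2 + 128*e2^2*e3 -
      800*e2*e5 + 960*e3*e4)*s*t + (-1024*e1^3*e5 + 64*e1^2*e2*e4 + 3520*e1*e2*e5 + 192*e1*e3*e4 -
      256*e2^2*e4 - 4800*e3*e5)*s^2 := by
  subst h1 h2 h3 h4 h5
  simp only [hessDiag, hessMinorThree]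
  ring

/-- Half the Hessian matrix of Igusa's quartic, for `s` and `t` the first and second elementary
symmetric polynomials in the coordinates of `x`. -/
def halfHessian {R : Type*} [CommRing R] (s t : R) (x : Fin 5 → R) : Matrix (Fin 5) (Fin 5) R :=
  Matrix.diagonal (fun i => hessDiag s t (x i)) + hessKernel s t x

theorem det_halfHessian {R : Type*} [CommRing R] {a b c d e e1 e2 e3 e4 e5 : R}
    (h1 : e1 = a + b + c + d + e)
    (h2 : e2 = a*b + a*c + a*d + a*e + b*c + b*d + b*e + c*d + c*e + d*e)
    (h3 : e3 = a*b*c + a*b*d + a*b*e + a*c*d + a*c*e + a*d*e + b*c*d + b*c*e + b*d*e + c*d*e)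
    (h4 : e4 = a*b*c*d + a*b*c*e + a*b*d*e + a*c*d*e + b*c*d*e) (h5 : e5 = a*b*c*d*e) :
    (halfHessian e1 e2 ![a, b, c, d, e]).det =
      -12 * ((e1^2 - 2*e2)*(e2^2 - 2*e1*e3 + 2*e4)^2 - 3*(e1^2 - 2*e2)^2*(e3^2 - 2*e2*e4 + 2*e1*e5) +
        12*(e1^2 - 2*e2)*(e4^2 - 2*e3*e5) - 48*e5^2 + (-(e2^2 - 2*e1*e3 + 2*e4)^2 + 2*(e1^2 -
        2*e2)*(e3^2 - 2*e2*e4 + 2*e1*e5) + 4*(e4^2 - 2*e3*e5))*e1^2 + (e3^2 - 2*e2*e4 +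
        2*e1*e5)*e1^4 - e1*e5*(-6*(e1^2 - 2*e2)^2 + 16*(e2^2 - 2*e1*e3 + 2*e4) + 4*(e1^2 -
        2*e2)*e1^2 + 2*e1^4)) := by
  have z5 : (hessKernel e1 e2 ![a, b, c, d, e]).det = 0 := det_hessKernel_eq_zero (m := 1) _ _ _
  have z4 : ∀ x : Fin 4 → R, (hessKernel e1 e2 x).det = 0 := det_hessKernel_eq_zero (m := 0) _ _
  rw [halfHessian, Matrix.det_diagonal_add_fin_five]
  simp only [hessKernel_submatrix, hessKernel_apply_self, det_hessKernel_two, det_hessKernel_three,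
    z4, z5]
  simp
  linear_combination sum_hessDiag_prod e1 e2 h1 h2 h3 h4 h5 +
    sum_hessMinorOne e1 e2 h1 h2 h3 h4 h5 + sum_hessMinorTwo e1 e2 h1 h2 h3 h4 h5 +
    sum_hessMinorThree e1 e2 h1 h2 h3 h4 h5

theorem aeval_Fpoly {R : Type*} [CommRing R] [Algebra ℚ R] {a b c d e e1 e2 e3 e4 e5 : R}
    (h1 : e1 = a + b + c + d + e)
    (h2 : e2 = a*b + a*c + a*d + a*e + b*c + b*d + b*e + c*d + c*e + d*e)
    (h3 : e3 = a*b*c + a*b*d + a*b*e + a*c*d + a*c*e + a*d*e + b*c*d + b*c*e + b*d*e + c*d*e)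
    (h4 : e4 = a*b*c*d + a*b*c*e + a*b*d*e + a*c*d*e + b*c*d*e) (h5 : e5 = a*b*c*d*e) :
    MvPolynomial.aeval ![e1, a, b, c, d, e] Fpoly =
      (e1^2 - 2*e2)*(e2^2 - 2*e1*e3 + 2*e4)^2 - 3*(e1^2 - 2*e2)^2*(e3^2 - 2*e2*e4 + 2*e1*e5) +
      12*(e1^2 - 2*e2)*(e4^2 - 2*e3*e5) - 48*e5^2 + (-(e2^2 - 2*e1*e3 + 2*e4)^2 + 2*(e1^2 -
      2*e2)*(e3^2 - 2*e2*e4 + 2*e1*e5) + 4*(e4^2 - 2*e3*e5))*e1^2 + (e3^2 - 2*e2*e4 +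
      2*e1*e5)*e1^4 - e1*e5*(-6*(e1^2 - 2*e2)^2 + 16*(e2^2 - 2*e1*e3 + 2*e4) + 4*(e1^2 -
      2*e2)*e1^2 + 2*e1^4) := by
  have hS1 : a^2 + b^2 + c^2 + d^2 + e^2 = e1^2 - 2*e2 := by
    subst h1 h2
    ring
  have hS2 : a^2*b^2 + a^2*c^2 + a^2*d^2 + a^2*e^2 + b^2*c^2 + b^2*d^2 + b^2*e^2 + c^2*d^2 +
      c^2*e^2 + d^2*e^2 = e2^2 - 2*e1*e3 + 2*e4 := by
    subst h1 h2 h3 h4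
    ring
  have hS3 : a^2*b^2*c^2 + a^2*b^2*d^2 + a^2*b^2*e^2 + a^2*c^2*d^2 + a^2*c^2*e^2 + a^2*d^2*e^2 +
      b^2*c^2*d^2 + b^2*c^2*e^2 + b^2*d^2*e^2 + c^2*d^2*e^2 = e3^2 - 2*e2*e4 + 2*e1*e5 := by
    subst h1 h2 h3 h4 h5
    ring
  have hS4 : a^2*b^2*c^2*d^2 + a^2*b^2*c^2*e^2 + a^2*b^2*d^2*e^2 + a^2*c^2*d^2*e^2 +
      b^2*c^2*d^2*e^2 = e4^2 - 2*e3*e5 := by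
    subst h3 h4 h5
    ring
  have hS5 : a^2*b^2*c^2*d^2*e^2 = e5^2 := by
    subst h5
    ring
  have hx : e1*a*b*c*d*e = e1*e5 := by
    subst h5
    ring
  simp [Fpoly, hS1, hS2, hS3, hS4, hS5, hx]

open MvPolynomial in
theorem pderiv_pderiv_Gpoly :
    (Matrix.of fun i j : Fin 5 => pderiv i (pderiv j Gpoly)) =
      (2 : MvPolynomial (Fin 5) ℚ) •
        halfHessian (X 0 + X 1 + X 2 + X 3 + X 4)
          (X 0*X 1 + X 0*X 2 + X 0*X 3 + X 0*X 4 + X 1*X 2 + X 1*X 3 + X 1*X 4 + X 2*X 3 +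
            X 2*X 4 + X 3*X 4) ![X 0, X 1, X 2, X 3, X 4] := by
  have h4 : ∀ k : Fin 5, pderiv k (4 : MvPolynomial (Fin 5) ℚ) = 0 := fun k =>
    pderiv_C (a := 4)
  have h2 : ∀ k : Fin 5, pderiv k (2 : MvPolynomial (Fin 5) ℚ) = 0 := fun k =>
    pderiv_C (a := 2)
  have hX : ∀ i j : Fin 5, pderiv (R := ℚ) i (X j) = if j = i then 1 else 0 := fun i j => by
    simp [pderiv_X, Pi.single_apply]
  ext1 i j
  simp only [Gpoly, halfHessian, hessDiag, hessKernel, Matrix.of_apply, Matrix.add_apply,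
    Matrix.smul_apply, Matrix.diagonal_apply, smul_eq_mul,
    Derivation.leibniz, Derivation.leibniz_pow, map_add, map_sub, hX, h4]
  fin_cases j <;> fin_cases i <;> simp [hX, h2] <;> ring

open MvPolynomial in
/-- There is a nonzero constant `c ∈ ℚ` with
`F(X₁+X₂+X₃+X₆+X₇, X₁, X₂, X₃, X₆, X₇) = c · det(∂²G/∂Xᵢ∂Xⱼ)`, i.e. the hyperplane
section of `𝒳` by the reflection hyperplane `H_α : X₀ = X₁+X₂+X₃+X₆+X₇` is the
Hessian hypersurface `𝒲₁₀` of Igusa's quartic. -/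
theorem stmt_14 :
    ∃ c : ℚ, c ≠ 0 ∧
      aeval (![X 0 + X 1 + X 2 + X 3 + X 4, X 0, X 1, X 2, X 3, X 4] :
          Fin 6 → MvPolynomial (Fin 5) ℚ) Fpoly
        = C c * Matrix.det (Matrix.of fun i j : Fin 5 => pderiv i (pderiv j Gpoly)) := by
  refine ⟨-1 / 384, by norm_num, ?_⟩
  rw [pderiv_pderiv_Gpoly, Matrix.det_smul, det_halfHessian rfl rfl rfl rfl rfl,
    ← aeval_Fpoly rfl rfl rfl rfl rfl, Fintype.card_fin]
  have h : C (-1 / 384) * (2 ^ 5 * -12) = (1 : MvPolynomial (Fin 5) ℚ) := by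
    rw [← map_ofNat C 2, ← map_ofNat C 12, ← map_pow, ← map_neg, ← map_mul, ← map_mul, ← map_one C]
    norm_num
  generalize (aeval _ Fpoly : MvPolynomial (Fin 5) ℚ) = P
  linear_combination (-P) * h
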